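/- Let 𝒮 = (p_m,q_m)_m be a sequence of pairs of positive integers such that (p_m)_m is unbounded. Then there exist a weight φ and an increasing sequence μ of positive integers such that U_0^{(μ,φ)}(𝔻) ⊂ 𝒰^𝒮(𝔻), where 𝒰^𝒮(𝔻) is the set of Padé universal series in 𝔻 with respect to 𝒮: functions f ∈ H(𝔻) such that for every compact K ⊂ ℂ ∖ 𝔻 with connected complement and every h ∈ A(K), there is a subsequence (λ_n)_n of ℕ with f ∈ 𝒟_{p_{λ_n},q_{λ_n}} for all n, [f; p_{λ_n}/q_{λ_n}] → h in A(K), and [f; p_{λ_n}/q_{λ_n}] → f in H(𝔻). -/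

import Mathlib

open Polynomial Filter Finset Metric Topology

noncomputable section

/-- Coefficient sequence extended to integer indices, with `a k = 0` for `k < 0`. -/
def acoefZ (a : ℕ → ℂ) (k : ℤ) : ℂ := if 0 ≤ k then a k.toNat else 0

/-- The Hankel determinant `C_{m,n} = det (a_{m-n+1+i+j})_{0 ≤ i,j ≤ n-1}`. -/
def hankelDet (a : ℕ → ℂ) (m n : ℕ) : ℂ :=
  Matrix.det (Matrix.of fun i j : Fin n => acoefZ a ((m : ℤ) - n + 1 + i + j))

/-- `IsPade a m n P Q` : the rational function `P/Q` is the Padé approximant of type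
`(m,n)` of the formal power series `∑ a_k z^k`. -/
def IsPade (a : ℕ → ℂ) (m n : ℕ) (P Q : Polynomial ℂ) : Prop :=
  P.natDegree ≤ m ∧ Q.natDegree ≤ n ∧ IsCoprime P Q ∧ Q.coeff 0 = 1 ∧
    ∀ j ≤ m + n, (∑ i ∈ Finset.range (j + 1), Q.coeff i * a (j - i)) = P.coeff j

/-- `𝒟_{m,n}` : the set of coefficient sequences whose Hankel determinant `C_{m,n}`
does not vanish. -/
def Dset (m n : ℕ) : Set (ℕ → ℂ) := {a | hankelDet a m n ≠ 0}

/-- `𝒩_{m,n}` : the subset of `𝒟_{m,n}` of series whose Padé denominator has exact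
degree `n`. -/
def Nset (m n : ℕ) : Set (ℕ → ℂ) :=
  {a | hankelDet a m n ≠ 0 ∧
    ∃ P Q : Polynomial ℂ, IsPade a m n P Q ∧ Q.degree = (n : WithBot ℕ)}

/-- The open unit disc in `ℂ`. -/
def unitD : Set ℂ := Metric.ball (0 : ℂ) 1

/-- The submodule of `ℂ → ℂ` of functions holomorphic on `Ω` (normalized to vanish
outside `Ω`, so that a function is determined by its restriction to `Ω`). -/
def holSubmodule (Ω : Set ℂ) : Submodule ℂ (ℂ → ℂ) where
  carrier := {f | DifferentiableOn ℂ f Ω ∧ ∀ z ∉ Ω, f z = 0}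
  add_mem' := fun hf hg => ⟨hf.1.add hg.1, fun z hz => by simp [hf.2 z hz, hg.2 z hz]⟩
  zero_mem' := ⟨differentiableOn_const 0, fun _ _ => rfl⟩
  smul_mem' := fun c f hf => ⟨hf.1.const_smul c, fun z hz => by simp [hf.2 z hz]⟩

/-- `H(Ω)`, the space of holomorphic functions on `Ω`. -/
abbrev Hol (Ω : Set ℂ) := ↥(holSubmodule Ω)

/-- The topology of uniform convergence on compact subsets of `Ω` on `H(Ω)`. -/
instance holTop (Ω : Set ℂ) : TopologicalSpace (Hol Ω) :=
  TopologicalSpace.induced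
    (fun f : Hol Ω => UniformOnFun.ofFun {K : Set Ω | IsCompact K} fun z : Ω => f.1 z)
    inferInstance

/-- The `k`-th Taylor coefficient at `0` of a function `f`. -/
def tc (f : ℂ → ℂ) (k : ℕ) : ℂ := iteratedDeriv k f 0 / k.factorial

/-- A weight : a strictly increasing function `φ : ℝ₊ → ℝ₊` with `φ(x) → ∞` and
`φ(x)/x → 0` as `x → ∞`. -/
def IsWeight (φ : ℝ → ℝ) : Prop :=
  StrictMonoOn φ (Set.Ici 0) ∧ (∀ x : ℝ, 0 ≤ x → 0 ≤ φ x) ∧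
    Tendsto φ atTop atTop ∧ Tendsto (fun x => φ x / x) atTop (nhds 0)

/-- The `N`-th Taylor partial sum `S_N(f)` of `f` at `0`, evaluated at `z`. -/
def psum (f : ℂ → ℂ) (N : ℕ) (z : ℂ) : ℂ := ∑ k ∈ Finset.range (N + 1), tc f k * z ^ k

/-- `U0Gaps φ μ f p q` : `f` has Ostrowski-gaps `(p_m, q_m)_m` with respect to the
weight `φ` (i.e. `p_0 < q_0 ≤ p_1 < q_1 ≤ …`, `q_m/p_m → ∞`, `|a_n|^{1/n} → 0` along
the gap set `I = ⋃_m {p_m+1, …, q_m}`, and `p_m < φ(q_m) < q_m`), `(p_m)_m` is a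
subsequence of `μ`, `a_{p_m} ≠ 0` for every `m`, and the Taylor coefficients of `f`
vanish on all the gaps. -/
def U0Gaps (φ : ℝ → ℝ) (μ : ℕ → ℕ) (f : ℂ → ℂ) (p q : ℕ → ℕ) : Prop :=
  (∀ m, 0 < p m) ∧ (∀ m, p m < q m) ∧ (∀ m, q m ≤ p (m + 1)) ∧
  Tendsto (fun m => (q m : ℝ) / (p m : ℝ)) atTop atTop ∧
  (∀ ε : ℝ, 0 < ε → ∃ N : ℕ, ∀ m k, p m < k → k ≤ q m → N ≤ k →
    ‖tc f k‖ ^ ((1 : ℝ) / (k : ℝ)) ≤ ε) ∧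
  (∀ m, (p m : ℝ) < φ (q m) ∧ φ (q m) < (q m : ℝ)) ∧
  (∃ σ : ℕ → ℕ, StrictMono σ ∧ ∀ m, p m = μ (σ m)) ∧
  (∀ m, tc f (p m) ≠ 0) ∧
  (∀ m k, p m < k → k ≤ q m → tc f k = 0)

/-- `U_0^{(μ,φ)}(𝔻)` : the set of `f ∈ H(𝔻)` having Ostrowski-gaps `(p_m, q_m)_m` with
respect to `φ` as in `U0Gaps`, and such that for every compact `K ⊆ ℂ ∖ 𝔻` with
connected complement and every `h ∈ A(K)` there is a sequence `(λ_n)_n` with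
`‖S_{p_{λ_n}}(f) - h‖_K → 0`. -/
def U0set (φ : ℝ → ℝ) (μ : ℕ → ℕ) : Set (Hol unitD) :=
  {f | ∃ p q : ℕ → ℕ, U0Gaps φ μ f.1 p q ∧
    ∀ K : Set ℂ, IsCompact K → Disjoint K unitD → IsConnected Kᶜ →
    ∀ h : ℂ → ℂ, ContinuousOn h K → DifferentiableOn ℂ h (interior K) →
    ∃ lam : ℕ → ℕ,
      TendstoUniformlyOn (fun n z => psum f.1 (p (lam n)) z) h atTop K}
/-- `𝒰^𝒮(𝔻)` : the set of Padé universal series in `𝔻` with respect to the sequence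
`𝒮 = (p_m, q_m)_m` of pairs of degrees. -/
def padeUnivSet (p q : ℕ → ℕ) : Set (Hol unitD) :=
  {f | ∀ K : Set ℂ, IsCompact K → Disjoint K unitD → IsConnected Kᶜ →
    ∀ h : ℂ → ℂ, ContinuousOn h K → DifferentiableOn ℂ h (interior K) →
    ∃ σ : ℕ → ℕ, StrictMono σ ∧ ∃ P Q : ℕ → Polynomial ℂ,
      (∀ n, tc f.1 ∈ Dset (p (σ n)) (q (σ n)) ∧
        IsPade (tc f.1) (p (σ n)) (q (σ n)) (P n) (Q n)) ∧
      TendstoUniformlyOn (fun n z => (P n).eval z / (Q n).eval z) h atTop K ∧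
      TendstoLocallyUniformlyOn
        (fun n z => (P n).eval z / (Q n).eval z) f.1 atTop unitD}

/-- An unbounded sequence of naturals has a strictly increasing subsequence. -/
lemma exists_strictMono_comp_of_unbounded (p : ℕ → ℕ) (hub : ∀ N : ℕ, ∃ m, N < p m) :
    ∃ J : ℕ → ℕ, StrictMono J ∧ StrictMono (p ∘ J) := by
  have step : ∀ m, ∃ m', m < m' ∧ p m < p m' := by
    intro m
    obtain ⟨m', hm'⟩ := hub (∑ i ∈ range (m + 1), p i)
    have key : ∀ i ≤ m, p i ≤ ∑ i ∈ range (m + 1), p i := fun i hi =>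
      Finset.single_le_sum (f := p) (fun _ _ => Nat.zero_le _) (by simp; omega)
    refine ⟨m', ?_, (key m le_rfl).trans_lt hm'⟩
    by_contra! h
    exact absurd (key m' h) (by omega)
  choose s hs using step
  refine ⟨fun n => s^[n] 0, strictMono_nat_of_lt_succ fun n => ?_,
    strictMono_nat_of_lt_succ fun n => ?_⟩
  · rw [Function.iterate_succ_apply']; exact (hs _).1
  · simp only [Function.comp_apply]
    rw [Function.iterate_succ_apply']; exact (hs _).2

/-- There are weights growing arbitrarily slowly along a prescribed sequence. -/
lemma exists_weight_le (N : ℕ → ℕ) :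
    ∃ φ : ℝ → ℝ, IsWeight φ ∧ ∀ k, φ (N k) ≤ k + 1 := by
  classical
  set M : ℕ → ℕ := fun k => k ^ 2 + ∑ i ∈ range (k + 1), N i with hM
  have hNM : ∀ k, N k ≤ M k := fun k =>
    (Finset.single_le_sum (f := N) (fun _ _ => Nat.zero_le _) (by simp)).trans
      (Nat.le_add_left _ _)
  have hsq : ∀ k, k ^ 2 ≤ M k := fun k => Nat.le_add_right _ _
  have hmono : Monotone M := fun a b hab =>
    Nat.add_le_add (Nat.pow_le_pow_left hab 2)
      (Finset.sum_le_sum_of_subset (Finset.range_mono (by omega)))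
  have hex : ∀ x : ℝ, ∃ k, x ≤ M k := by
    intro x
    obtain ⟨k, hk⟩ := exists_nat_ge x
    refine ⟨k, hk.trans ?_⟩
    exact_mod_cast (Nat.le_self_pow two_ne_zero k).trans (hsq k)
  set g : ℝ → ℕ := fun x => Nat.find (hex x) with hg
  have gle : ∀ x : ℝ, ∀ k, x ≤ M k → g x ≤ k := fun x k h => Nat.find_min' (hex x) h
  have gmono : Monotone g := fun x y hxy => gle x _ (hxy.trans (Nat.find_spec (hex y)))
  have ggt : ∀ k, ∀ x : ℝ, (M k : ℝ) < x → k < g x := by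
    intro k x hx
    by_contra! h
    have h1 : x ≤ M (g x) := Nat.find_spec (hex x)
    have h2 : (M (g x) : ℝ) ≤ M k := by exact_mod_cast hmono h
    linarith
  have gsqrt : ∀ x : ℝ, 0 ≤ x → (g x : ℝ) ≤ √x + 1 := by
    intro x hx
    rcases Nat.eq_zero_or_pos (g x) with h | h
    · rw [h, Nat.cast_zero]; positivity
    · have h1 : ¬ x ≤ M (g x - 1) := Nat.find_min (hex x) (Nat.sub_lt h one_pos)
      have h2 : ((g x - 1 : ℕ) : ℝ) ^ 2 ≤ M (g x - 1) := by exact_mod_cast hsq (g x - 1)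
      have h3 : ((g x - 1 : ℕ) : ℝ) ≤ √x := Real.le_sqrt_of_sq_le (by linarith)
      rw [Nat.cast_sub h] at h3
      push_cast at h3
      linarith
  have hfrac : ∀ x : ℝ, 0 ≤ x → x / (1 + x) ≤ 1 := fun x hx =>
    (div_le_one (by positivity)).2 (by linarith)
  have hfrac0 : ∀ x : ℝ, 0 ≤ x → 0 ≤ x / (1 + x) := fun x hx => by positivity
  refine ⟨fun x => g x + x / (1 + x), ⟨?_, ?_, ?_, ?_⟩, ?_⟩
  · intro x hx y hy hxy
    simp only [Set.mem_Ici] at hx hy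
    refine add_lt_add_of_le_of_lt (by exact_mod_cast gmono hxy.le) ?_
    rw [div_lt_div_iff₀ (by positivity) (by positivity)]
    nlinarith
  · intro x hx
    exact add_nonneg (Nat.cast_nonneg _) (hfrac0 x hx)
  · have hgt : Tendsto g atTop atTop := tendsto_atTop.2 fun k => by
      filter_upwards [eventually_gt_atTop (M k : ℝ)] with x hx using (ggt k x hx).le
    refine tendsto_atTop_mono' atTop ?_ (tendsto_natCast_atTop_atTop.comp hgt)
    filter_upwards [eventually_ge_atTop 0] with x hx
    simpa using hfrac0 x hx
  · have hlim : Tendsto (fun x : ℝ => (√x)⁻¹ + 2 * x⁻¹) atTop (𝓝 0) := by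
      have := (tendsto_inv_atTop_zero.comp Real.tendsto_sqrt_atTop).add
        ((tendsto_inv_atTop_zero (𝕜 := ℝ)).const_mul 2)
      simpa using this
    refine squeeze_zero' ?_ ?_ hlim
    · filter_upwards [eventually_ge_atTop 0] with x hx
      exact div_nonneg (add_nonneg (Nat.cast_nonneg _) (hfrac0 x hx)) hx
    · filter_upwards [eventually_gt_atTop 0] with x hx
      have h1 : (g x : ℝ) + x / (1 + x) ≤ √x + 2 := by
        linarith [gsqrt x hx.le, hfrac x hx.le]
      calc ((g x : ℝ) + x / (1 + x)) / x ≤ (√x + 2) / x := by gcongr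
        _ = (√x)⁻¹ + 2 * x⁻¹ := by
          rw [add_div, Real.sqrt_div_self, div_eq_mul_inv]
  · intro k
    have h1 : (g (N k) : ℝ) ≤ k := by
      exact_mod_cast gle _ k (by exact_mod_cast hNM k)
    have h2 := hfrac (N k) (Nat.cast_nonneg _)
    simp only
    linarith

/-- The Hankel determinant at the beginning of a gap is triangular. -/
lemma hankelDet_ne_zero_of_gap (a : ℕ → ℂ) (m n : ℕ) (hm : a m ≠ 0)
    (hgap : ∀ k, m < k → k ≤ m + n → a k = 0) : hankelDet a m n ≠ 0 := by
  set A : Matrix (Fin n) (Fin n) ℂ :=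
    Matrix.of fun i j : Fin n => acoefZ a ((m : ℤ) - n + 1 + i + j) with hA
  have hentry : ∀ i j : Fin n,
      A.submatrix id Fin.revPerm i j = acoefZ a ((m : ℤ) + i - j) := by
    intro i j
    have hj := j.2
    simp only [hA, Matrix.submatrix_apply, Matrix.of_apply, id, Fin.revPerm_apply, Fin.val_rev]
    congr 1
    omega
  have htri : (A.submatrix id Fin.revPerm).BlockTriangular id := by
    intro i j hij
    simp only [id] at hij
    have hij' : (j : ℕ) < i := hij
    have hi := i.2
    rw [hentry, acoefZ, if_pos (by omega)]
    exact hgap _ (by omega) (by omega)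
  have hdet : (A.submatrix id Fin.revPerm).det = a m ^ n := by
    rw [Matrix.det_of_isUpperTriangular htri]
    simp only [hentry]
    simp [acoefZ]
  intro h0
  rw [Matrix.det_permute', show A.det = 0 from h0, mul_zero] at hdet
  exact pow_ne_zero n hm hdet.symm

/-- At the beginning of a gap, the Padé approximant is the Taylor partial sum. -/
lemma isPade_of_gap (a : ℕ → ℂ) (m n : ℕ) (hgap : ∀ k, m < k → k ≤ m + n → a k = 0) :
    IsPade a m n (∑ k ∈ range (m + 1), monomial k (a k)) 1 := by
  refine ⟨?_, by simp, isCoprime_one_right, by simp, fun j hj => ?_⟩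
  · exact natDegree_sum_le_of_forall_le _ _ fun k hk =>
      (natDegree_monomial_le _).trans (by simp at hk; omega)
  · rw [Finset.sum_eq_single 0 (by intro i _ hi; simp [coeff_one, hi]) (by simp)]
    simp only [finsetSum_coeff, coeff_monomial, Finset.sum_ite_eq', Finset.mem_range,
      coeff_one_zero, one_mul, Nat.sub_zero]
    split_ifs with h
    · rfl
    · exact hgap j (by omega) hj

/-- Taylor partial sums converge locally uniformly in the unit disc. -/
lemma tendstoLocallyUniformlyOn_psum (f : ℂ → ℂ) (hf : DifferentiableOn ℂ f unitD) :
    TendstoLocallyUniformlyOn (fun N z => psum f N z) f atTop unitD := by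
  have key : ∀ r : NNReal, 0 < r → r < 1 →
      TendstoLocallyUniformlyOn (fun N z => psum f N z) f atTop (ball 0 r) := by
    intro r hr hr1
    have hsub : closedBall (0 : ℂ) r ⊆ unitD := closedBall_subset_ball (by exact_mod_cast hr1)
    have h1 := (hf.mono hsub).hasFPowerSeriesOnBall hr
    have h2 : HasFPowerSeriesAt f
        (FormalMultilinearSeries.ofScalars ℂ (fun n => iteratedDeriv n f 0 / n.factorial)) 0 :=
      h1.analyticAt.hasFPowerSeriesAt
    rw [h1.hasFPowerSeriesAt.eq_formalMultilinearSeries h2] at h1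
    have h3 := h1.tendstoLocallyUniformlyOn'
    rw [Metric.eball_coe] at h3
    intro u hu x hx
    obtain ⟨t, ht, hev⟩ := h3 u hu x hx
    refine ⟨t, ht, ?_⟩
    filter_upwards [(tendsto_add_atTop_nat 1).eventually hev] with N hN y hy
    have := hN y hy
    simpa [FormalMultilinearSeries.partialSum, psum, tc,
      FormalMultilinearSeries.ofScalars_apply_eq, mul_comm] using this
  intro u hu x hx
  have hx' : ‖x‖ < 1 := by simpa [unitD] using hx
  obtain ⟨r, hxr, hr1⟩ := exists_between hx'
  have hr0 : 0 < r := (norm_nonneg x).trans_lt hxr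
  lift r to NNReal using hr0.le
  have hxb : x ∈ ball (0 : ℂ) r := by simpa using hxr
  obtain ⟨t, ht, hev⟩ := key r (by exact_mod_cast hr0) (by exact_mod_cast hr1) u hu x hxb
  rw [isOpen_ball.nhdsWithin_eq hxb] at ht
  exact ⟨t, mem_nhdsWithin_of_mem_nhds ht, hev⟩

/-- If every translate of `h` by a constant is a uniform limit of terms of `F`, then `h` is the
uniform limit of a genuine subsequence of `F`. -/
lemma exists_strictMono_tendstoUniformlyOn (F : ℕ → ℂ → ℂ) (K : Set ℂ) (h : ℂ → ℂ)
    (H : ∀ c : ℂ, ∃ lam : ℕ → ℕ,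
      TendstoUniformlyOn (fun n => F (lam n)) (fun z => h z + c) atTop K) :
    ∃ j : ℕ → ℕ, StrictMono j ∧ TendstoUniformlyOn (fun n => F (j n)) h atTop K := by
  rcases K.eq_empty_or_nonempty with rfl | ⟨w, hw⟩
  · exact ⟨id, strictMono_id, tendstoUniformlyOn_empty⟩
  have hfreq : ∀ n : ℕ, ∃ᶠ k in atTop, ∀ z ∈ K, dist (h z) (F k z) < 1 / ((n : ℝ) + 1) := by
    intro n
    rw [frequently_atTop]
    intro J
    set δ : ℝ := 1 / ((n : ℝ) + 1) with hδ
    have hδ0 : 0 < δ := by positivity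
    set E : Set ℂ := (fun k => F k w) '' Set.Iio J with hE
    have hEfin : E.Finite := (Set.finite_Iio J).image _
    obtain ⟨v, hv, hvE⟩ : (ball (h w) (δ / 2) \ E).Nonempty :=
      ((infinite_of_mem_nhds (h w) (ball_mem_nhds _ (by positivity))).sdiff hEfin).nonempty
    obtain ⟨lam, hlam⟩ := H (v - h w)
    have hlim : Tendsto (fun n => F (lam n) w) atTop (𝓝 v) := by
      simpa using hlam.tendsto_at hw
    have hev1 := hlim.eventually (hEfin.isClosed.isOpen_compl.mem_nhds hvE)
    have hev2 := Metric.tendstoUniformlyOn_iff.1 hlam (δ / 2) (by positivity)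
    obtain ⟨k, hk1, hk2⟩ := (hev1.and hev2).exists
    refine ⟨lam k, ?_, fun z hz => ?_⟩
    · by_contra! hlt
      exact hk1 ⟨lam k, hlt, rfl⟩
    · calc dist (h z) (F (lam k) z)
          ≤ dist (h z) (h z + (v - h w)) + dist (h z + (v - h w)) (F (lam k) z) :=
            dist_triangle _ _ _
        _ < δ / 2 + δ / 2 := by
            refine add_lt_add ?_ (hk2 z hz)
            rw [dist_self_add_right, ← dist_eq_norm]
            exact hv
        _ = δ := by ring
  obtain ⟨j, hj, hjK⟩ := extraction_forall_of_frequently hfreq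
  refine ⟨j, hj, Metric.tendstoUniformlyOn_iff.2 fun ε hε => ?_⟩
  filter_upwards [(tendsto_one_div_add_atTop_nhds_zero_nat (𝕜 := ℝ)).eventually_lt_const hε]
    with n hn z hz using (hjK n z hz).trans hn

/-- Proposition 5.8 : for a sequence `𝒮 = (p_m, q_m)_m` of pairs of positive integers
with `(p_m)_m` unbounded, there exist a weight `φ` and an increasing sequence `μ` of
positive integers with `U_0^{(μ,φ)}(𝔻) ⊆ 𝒰^𝒮(𝔻)`. -/
theorem stmt_19 (p q : ℕ → ℕ) (hp : ∀ m, 0 < p m) (hq : ∀ m, 0 < q m)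
    (hub : ∀ N : ℕ, ∃ m, N < p m) :
    ∃ φ : ℝ → ℝ, ∃ μ : ℕ → ℕ, IsWeight φ ∧ StrictMono μ ∧ (∀ n, 0 < μ n) ∧
      U0set φ μ ⊆ padeUnivSet p q := by
  obtain ⟨J, hJ, hpJ⟩ := exists_strictMono_comp_of_unbounded p hub
  obtain ⟨φ, hφ, hφle⟩ := exists_weight_le fun k => p (J k) + q (J k)
  refine ⟨φ, p ∘ J, hφ, hpJ, fun n => hp _, ?_⟩
  rintro f ⟨p', q', ⟨-, -, -, -, -, hφq, ⟨s, hs, hps⟩, hne, hgap⟩, happrox⟩ K hK hKD hKc h hc hd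
  obtain ⟨j, hj, hjK⟩ := exists_strictMono_tendstoUniformlyOn
    (fun n z => psum f.1 (p' n) z) K h fun c =>
      happrox K hK hKD hKc (fun z => h z + c) (hc.add continuousOn_const)
        (hd.add (differentiableOn_const c))
  have hlen : ∀ m, p' m + q (J (s m)) ≤ q' m := by
    intro m
    by_contra! hlt
    have hps' : p' m = p (J (s m)) := hps m
    have h1 : φ (q' m) < φ ((p (J (s m)) + q (J (s m)) : ℕ) : ℝ) :=
      hφ.1 (Set.mem_Ici.2 (Nat.cast_nonneg _)) (Set.mem_Ici.2 (Nat.cast_nonneg _))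
        (by rw [← hps']; exact_mod_cast hlt)
    have h2 := hφle (s m)
    have h3 := (hφq m).1
    have h4 : ∀ k, k + 1 ≤ p (J k) := by
      intro k
      induction k with
      | zero => exact hp _
      | succ k ih => exact Nat.succ_le_of_lt (ih.trans_lt (hpJ (Nat.lt_succ_self k)))
    have h5 : ((s m : ℝ) + 1) ≤ p' m := by rw [hps']; exact_mod_cast h4 (s m)
    linarith
  have hgap' : ∀ m k, p' m < k → k ≤ p' m + q (J (s m)) → tc f.1 k = 0 :=
    fun m k h1 h2 => hgap m k h1 (h2.trans (hlen m))
  have heval : ∀ (m : ℕ) (z : ℂ),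
      (∑ k ∈ range (m + 1), monomial k (tc f.1 k)).eval z / (1 : ℂ[X]).eval z = psum f.1 m z := by
    intro m z
    simp [eval_finsetSum, psum]
  refine ⟨fun n => J (s (j n)), hJ.comp (hs.comp hj),
    fun n => ∑ k ∈ range (p' (j n) + 1), monomial k (tc f.1 k), fun _ => 1,
    fun n => ?_, ?_, ?_⟩
  · have hpn : p (J (s (j n))) = p' (j n) := (hps (j n)).symm
    rw [hpn]
    exact ⟨hankelDet_ne_zero_of_gap _ _ _ (hne _) (hgap' _), isPade_of_gap _ _ _ (hgap' _)⟩
  · simpa only [heval] using hjK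
  · have hp' : Tendsto (fun n => p' (j n)) atTop atTop := by
      have : (fun n => p' (j n)) = (p ∘ J) ∘ s ∘ j := funext fun n => hps (j n)
      rw [this]
      exact (hpJ.comp (hs.comp hj)).tendsto_atTop
    simp only [heval]
    intro u hu x hx
    obtain ⟨t, ht, hev⟩ := tendstoLocallyUniformlyOn_psum f.1 f.2.1 u hu x hx
    exact ⟨t, ht, hp'.eventually hev⟩

end
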